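/- arXiv:2406.20062 — 2 statements merged into one kernel-verified Lean document; each statement's English description precedes it below -/
import Mathlib

section
/- Let X be a nonempty set and a, b : X → ℝ. For θ ∈ ℝ define V(θ) = sup_{x ∈ X} (a(x) + θ·b(x)), and assume V(θ) is finite and attained by some maximizer for every θ ∈ ℝ. Fix θ₀ ∈ ℝ and v ∈ ℝ, and suppose DV = lim_{ε → 0⁺} (V(θ₀ + εv) − V(θ₀))/ε exists in ℝ. Assume that for every monotone sequence θₙ → θ₀ there exist maximizers xₙ of x ↦ a(x) + θₙ·b(x) and a maximizer x* of x ↦ a(x) + θ₀·b(x) such that b(xₙ) → b(x*). Then there exists a maximizer x* of x ↦ a(x) + θ₀·b(x) with DV = v·b(x*), and moreover v·b(x′) ≤ DV for every maximizer x′ of x ↦ a(x) + θ₀·b(x). -/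
open Filter Topology

/-- Sharp envelope theorem for objectives affine in the parameter: with
`f (x, θ) = a x + θ · b x` and value function `V θ = sup_x (a x + θ · b x)` finite and
attained for every `θ`, if the one-sided directional derivative `DV` of `V` at `θ₀` in
direction `v` exists, and for every monotone sequence `θₙ → θ₀` there are maximizers
`xₙ` at `θₙ` and `x*` at `θ₀` with `b xₙ → b x*`, then `DV = v · b x*` for some maximizer
`x*` at `θ₀`, and `v · b x′ ≤ DV` for every maximizer `x′` at `θ₀`. -/
theorem envelope_sharp_affine {X : Type*} [Nonempty X] (a b : X → ℝ) (V : ℝ → ℝ)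
    (hV : ∀ θ : ℝ, (∀ x : X, a x + θ * b x ≤ V θ) ∧ ∃ x : X, a x + θ * b x = V θ)
    (θ₀ v : ℝ) (DV : ℝ)
    (hDV : Tendsto (fun ε : ℝ => (V (θ₀ + ε * v) - V θ₀) / ε)
      (𝓝[>] (0 : ℝ)) (𝓝 DV))
    (hconv : ∀ θ : ℕ → ℝ, (Monotone θ ∨ Antitone θ) →
      Tendsto θ atTop (𝓝 θ₀) →
      ∃ (xn : ℕ → X) (xstar : X),
        (∀ n, a (xn n) + θ n * b (xn n) = V (θ n)) ∧
        (a xstar + θ₀ * b xstar = V θ₀) ∧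
        Tendsto (fun n => b (xn n)) atTop (𝓝 (b xstar))) :
    (∃ xstar : X, a xstar + θ₀ * b xstar = V θ₀ ∧ DV = v * b xstar) ∧
    (∀ x' : X, a x' + θ₀ * b x' = V θ₀ → v * b x' ≤ DV) := by
  have hlower : ∀ x' : X, a x' + θ₀ * b x' = V θ₀ → v * b x' ≤ DV := by
    intro x' hx'
    refine ge_of_tendsto hDV ?_
    filter_upwards [self_mem_nhdsWithin] with ε hε
    rw [le_div_iff₀ hε]
    linarith [(hV (θ₀ + ε * v)).1 x']
  refine ⟨?_, hlower⟩
  have hε : Tendsto (fun n : ℕ => 1 / ((n : ℝ) + 1)) atTop (𝓝 0) :=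
    tendsto_one_div_add_atTop_nhds_zero_nat
  have hpos : ∀ n : ℕ, 0 < 1 / ((n : ℝ) + 1) := fun _ => Nat.one_div_pos_of_nat
  have hanti : Antitone (fun n : ℕ => 1 / ((n : ℝ) + 1)) :=
    fun _ _ h => Nat.one_div_le_one_div h
  obtain ⟨xn, xstar, hxn, hxstar, hb⟩ := hconv (fun n : ℕ => θ₀ + 1 / ((n : ℝ) + 1) * v)
    (by
      rcases le_total 0 v with hv | hv
      · exact Or.inr fun _ _ h =>
          add_le_add_right (mul_le_mul_of_nonneg_right (hanti h) hv) _
      · exact Or.inl fun _ _ h =>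
          add_le_add_right (mul_le_mul_of_nonpos_right (hanti h) hv) _)
    (by simpa using (hε.mul_const v).const_add θ₀)
  refine ⟨xstar, hxstar, le_antisymm ?_ (hlower xstar hxstar)⟩
  have hquot := hDV.comp
    (tendsto_nhdsWithin_iff.2 ⟨hε, Eventually.of_forall fun n => hpos n⟩)
  refine le_of_tendsto_of_tendsto' hquot (hb.const_mul v) fun n => ?_
  rw [Function.comp_apply, div_le_iff₀ (hpos n)]
  linarith [hxn n, (hV θ₀).1 (xn n)]
end

section
/- Let μ ∈ ℝ, σ > 0, and y ∈ ℝ. Then the integral of t ↦ max(t − y, 0) with respect to the Gaussian measure on ℝ with mean μ and variance σ² equals (μ − y)·Φ((μ − y)/σ) + σ·φ((μ − y)/σ). -/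
open MeasureTheory ProbabilityTheory

/-- The standard normal density `φ(t) = (2π)^{-1/2} exp(−t²/2)`. -/
noncomputable def stdNormalPDF (t : ℝ) : ℝ :=
  (Real.sqrt (2 * Real.pi))⁻¹ * Real.exp (-t ^ 2 / 2)

/-- The standard normal cumulative distribution function `Φ(t) = ∫_{−∞}^t φ(s) ds`. -/
noncomputable def stdNormalCDF (t : ℝ) : ℝ :=
  ∫ s in Set.Iio t, stdNormalPDF s

lemma gaussianPDFReal_zero_one_eq_stdNormalPDF : gaussianPDFReal 0 1 = stdNormalPDF := by
  ext t
  simp [gaussianPDFReal, stdNormalPDF]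

lemma integrable_stdNormalPDF : Integrable stdNormalPDF :=
  gaussianPDFReal_zero_one_eq_stdNormalPDF ▸ integrable_gaussianPDFReal 0 1

lemma integrable_mul_stdNormalPDF : Integrable fun t ↦ t * stdNormalPDF t := by
  have h := (integrable_mul_exp_neg_mul_sq (b := 1 / 2) (by norm_num)).const_mul
    (Real.sqrt (2 * Real.pi))⁻¹
  refine h.congr (.of_forall fun t ↦ ?_)
  simp only [stdNormalPDF]
  rw [show -t ^ 2 / 2 = -(1 / 2) * t ^ 2 by ring]
  ring

lemma hasDerivAt_stdNormalPDF (t : ℝ) : HasDerivAt stdNormalPDF (-(t * stdNormalPDF t)) t := by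
  have h : HasDerivAt (fun s : ℝ ↦ -s ^ 2 / 2) (-t) t := by
    refine (((hasDerivAt_pow 2 t).neg).div_const 2).congr_deriv ?_
    norm_num
    ring
  refine (h.exp.const_mul (Real.sqrt (2 * Real.pi))⁻¹).congr_deriv ?_
  simp only [stdNormalPDF]
  ring

lemma setIntegral_Iio_mul_stdNormalPDF (a : ℝ) :
    ∫ t in Set.Iio a, t * stdNormalPDF t = -stdNormalPDF a := by
  have hlim : Filter.Tendsto stdNormalPDF Filter.atBot (nhds 0) :=
    tendsto_zero_of_hasDerivAt_of_integrableOn_Iic (a := a)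
      (fun t _ ↦ hasDerivAt_stdNormalPDF t)
      integrable_mul_stdNormalPDF.neg.integrableOn integrable_stdNormalPDF.integrableOn
  have h := integral_Iic_of_hasDerivAt_of_tendsto' (fun t _ ↦ hasDerivAt_stdNormalPDF t)
    (integrable_mul_stdNormalPDF.neg.integrableOn (s := Set.Iic a)) hlim
  rw [integral_neg, integral_Iic_eq_integral_Iio] at h
  linarith

/-- The standard normal law is symmetric, so the affine map may reverse orientation. -/
lemma gaussianReal_eq_map_sub_mul (μ σ : ℝ) :
    gaussianReal μ ⟨σ ^ 2, sq_nonneg σ⟩ = (gaussianReal 0 1).map fun z ↦ μ - σ * z := by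
  have h : (gaussianReal 0 1).map (fun z ↦ μ - σ * z) =
      ((gaussianReal 0 1).map (fun z ↦ σ * z)).map (fun z ↦ μ - z) :=
    (Measure.map_map (by fun_prop) (by fun_prop)).symm
  rw [h, gaussianReal_map_const_mul, gaussianReal_map_const_sub, mul_zero, sub_zero, mul_one]
  rfl

/-- Gaussian expected improvement formula: for a Gaussian measure with mean `μ` and
variance `σ²`, `∫ max(t − y, 0) dN(μ, σ²)(t) = (μ − y)·Φ((μ − y)/σ) + σ·φ((μ − y)/σ)`. -/
theorem gaussian_expected_improvement (μ σ : ℝ) (hσ : 0 < σ) (y : ℝ) :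
    ∫ t, max (t - y) 0 ∂(gaussianReal μ ⟨σ ^ 2, sq_nonneg σ⟩)
      = (μ - y) * stdNormalCDF ((μ - y) / σ) + σ * stdNormalPDF ((μ - y) / σ) := by
  set a := (μ - y) / σ
  have hind (z : ℝ) : stdNormalPDF z • max (μ - σ * z - y) 0 =
      (Set.Iio a).indicator
        (fun z ↦ (μ - y) * stdNormalPDF z - σ * (z * stdNormalPDF z)) z := by
    by_cases hz : z < a
    · have h := (lt_div_iff₀ hσ).1 hz
      rw [Set.indicator_of_mem (Set.mem_Iio.2 hz), max_eq_left (by linarith), smul_eq_mul]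
      ring
    · have h := (div_le_iff₀ hσ).1 (not_lt.1 hz)
      rw [Set.indicator_of_notMem (by simpa using hz), max_eq_right (by linarith), smul_zero]
  rw [gaussianReal_eq_map_sub_mul, integral_map (by fun_prop) (by fun_prop),
    integral_gaussianReal_eq_integral_smul one_ne_zero,
    gaussianPDFReal_zero_one_eq_stdNormalPDF]
  simp_rw [hind]
  rw [integral_indicator measurableSet_Iio,
    integral_sub (integrable_stdNormalPDF.const_mul _).integrableOn
      (integrable_mul_stdNormalPDF.const_mul _).integrableOn,
    integral_const_mul, integral_const_mul, setIntegral_Iio_mul_stdNormalPDF, stdNormalCDF]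
  ring
end
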